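/- Suppose ε ∈ {1,−1}, f31 = ε·f11, f32 = ε·f12, f22 is identically equal to a constant β, f11′ is nowhere zero, and ∂f12/∂z_{k−1} is nowhere zero. If smooth functions a, b, c on a nonempty open set U ⊆ ℝ² satisfy the Codazzi identities (C1), (C2) and the Gauss equation a·c − b² = −1, then at every (x,t) ∈ U: ∂a/∂x = ε·η·(a − c), ∂b/∂x = 2ε·η·b, ∂a/∂t = ε·β·(a − c), ∂b/∂t = 2ε·β·b, η·∂c/∂t − β·∂c/∂x = 0, and a is nowhere zero on U. -/

import Mathlib

open Real Finset

/-- Partial derivative of `f` at `z` in the `i`-th coordinate direction. -/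
noncomputable def pd {n : ℕ} (f : (Fin n → ℝ) → ℝ) (z : Fin n → ℝ) (i : ℕ) : ℝ :=
  fderiv ℝ f z (fun j => if (j : ℕ) = i then 1 else 0)

/-- The `i`-th coordinate of `z` (junk value `0` out of range). -/
def zc {n : ℕ} (z : Fin n → ℝ) (i : ℕ) : ℝ :=
  if h : i < n then z ⟨i, h⟩ else 0

/-- `f` depends only on the first `m` coordinates `z_0, …, z_{m-1}`. -/
def DependsOnFirst {n : ℕ} (m : ℕ) (f : (Fin n → ℝ) → ℝ) : Prop :=
  ∀ z w : Fin n → ℝ, (∀ j : Fin n, (j : ℕ) < m → z j = w j) → f z = f w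

/-- The structure equations (S1)–(S3), required at every point `(z_0, …, z_k) ∈ ℝ^{k+1}`. -/
def StructEqs (k : ℕ) (η : ℝ) (f11 f31 : ℝ → ℝ)
    (f12 f22 f32 F : (Fin (k+1) → ℝ) → ℝ) : Prop :=
  ∀ z : Fin (k+1) → ℝ,
    deriv f11 (z 0) * F z =
      (∑ i ∈ Finset.range k, pd f12 z i * zc z (i+1)) + η * f32 z - f31 (z 0) * f22 z ∧
    (∑ i ∈ Finset.range (k-1), pd f22 z i * zc z (i+1)) =
      f11 (z 0) * f32 z - f31 (z 0) * f12 z ∧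
    deriv f31 (z 0) * F z =
      (∑ i ∈ Finset.range k, pd f32 z i * zc z (i+1)) + η * f12 z - f11 (z 0) * f22 z

/-- The Codazzi identities (C1) and (C2), required for every `(x,t) ∈ U` and every
`(z_0, …, z_{k-1})` (equivalently, every `z ∈ ℝ^{k+1}` since the data does not
depend on `z_k`).  Here `(1,0)` is the `∂/∂x` direction and `(0,1)` the `∂/∂t` one. -/
def Codazzi (k : ℕ) (η : ℝ) (f11 f31 : ℝ → ℝ) (f12 f22 f32 : (Fin (k+1) → ℝ) → ℝ)
    (U : Set (ℝ × ℝ)) (a b c : ℝ × ℝ → ℝ) : Prop :=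
  ∀ p ∈ U, ∀ z : Fin (k+1) → ℝ,
    f11 (z 0) * fderiv ℝ a p (0, 1) + η * fderiv ℝ b p (0, 1)
      - f12 z * fderiv ℝ a p (1, 0) - f22 z * fderiv ℝ b p (1, 0)
      - 2 * b p * (f11 (z 0) * f32 z - f31 (z 0) * f12 z)
      + (a p - c p) * (η * f32 z - f31 (z 0) * f22 z) = 0 ∧
    f11 (z 0) * fderiv ℝ b p (0, 1) + η * fderiv ℝ c p (0, 1)
      - f12 z * fderiv ℝ b p (1, 0) - f22 z * fderiv ℝ c p (1, 0)
      + (a p - c p) * (f11 (z 0) * f32 z - f31 (z 0) * f12 z)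
      + 2 * b p * (η * f32 z - f31 (z 0) * f22 z) = 0

/-- If `f` is a function of `z_0` with nonvanishing derivative and `g` depends effectively on
some later coordinate, then `f`, `g` and the constant `1` are linearly independent. -/
lemma coeffs_eq_zero {k i : ℕ} (hi : 0 < i) {f : ℝ → ℝ} {g : (Fin (k + 1) → ℝ) → ℝ}
    (hf : deriv f 0 ≠ 0) (hg : Differentiable ℝ g) (hg' : pd g 0 i ≠ 0) {A B C : ℝ}
    (h : ∀ z : Fin (k + 1) → ℝ, A * f (z 0) + B * g z + C = 0) : A = 0 ∧ B = 0 ∧ C = 0 := by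
  have hB : B = 0 := by
    by_contra hB
    set e : Fin (k + 1) → ℝ := fun j => if (j : ℕ) = i then 1 else 0 with he
    have he0 : e 0 = 0 := by simp [he, hi.ne]
    have hconst : ∀ s : ℝ, g (0 + s • e) = g 0 := by
      intro s
      have h1 := h (0 + s • e)
      have h2 := h 0
      simp only [Pi.add_apply, Pi.smul_apply, he0, Pi.zero_apply, smul_zero, add_zero] at h1 h2
      exact mul_left_cancel₀ hB (by linarith)
    refine hg' ?_
    change fderiv ℝ g 0 e = 0
    rw [← (hg 0).lineDeriv_eq_fderiv]
    simp only [lineDeriv, hconst, deriv_const]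
  have hlin : ∀ s : ℝ, A * f s = -C := by
    intro s
    have := h (fun _ => s)
    rw [hB] at this
    linarith
  have hA : A = 0 := by
    have hd : deriv (fun s => A * f s) 0 = 0 := by simp [hlin]
    rw [deriv_const_mul_field] at hd
    exact (mul_eq_zero.1 hd).resolve_right hf
  refine ⟨hA, hB, ?_⟩
  have := hlin 0
  rw [hA] at this
  linarith

/-- In branch I (`f31 = ε·f11`, `f32 = ε·f12`, `f22 ≡ β`, `f11'`
nowhere zero, `∂f12/∂z_{k-1}` nowhere zero), any smooth solution `a, b, c` of the Codazzi
and Gauss equations on a nonempty open `U` satisfies the first-order system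
`a_x = ε·η·(a − c)`, `b_x = 2·ε·η·b`, `a_t = ε·β·(a − c)`, `b_t = 2·ε·β·b`,
`η·c_t − β·c_x = 0`, with `a` nowhere zero on `U`. -/
theorem stmt15 (k : ℕ) (hk : 2 ≤ k) (η : ℝ) (hη : η ≠ 0)
    (f11 f31 : ℝ → ℝ) (f12 f22 f32 : (Fin (k+1) → ℝ) → ℝ)
    (hf11 : ContDiff ℝ (⊤ : ℕ∞) f11) (hf31 : ContDiff ℝ (⊤ : ℕ∞) f31)
    (hf12 : ContDiff ℝ (⊤ : ℕ∞) f12) (hf22 : ContDiff ℝ (⊤ : ℕ∞) f22)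
    (hf32 : ContDiff ℝ (⊤ : ℕ∞) f32)
    (hdep12 : DependsOnFirst k f12) (hdep32 : DependsOnFirst k f32)
    (hdep22 : DependsOnFirst (k-1) f22)
    (ε : ℝ) (hε : ε = 1 ∨ ε = -1)
    (hI31 : ∀ z0 : ℝ, f31 z0 = ε * f11 z0)
    (hI32 : ∀ z : Fin (k+1) → ℝ, f32 z = ε * f12 z)
    (β : ℝ) (hI22 : ∀ z : Fin (k+1) → ℝ, f22 z = β)
    (hf11' : ∀ z0 : ℝ, deriv f11 z0 ≠ 0)
    (hf12' : ∀ z : Fin (k+1) → ℝ, pd f12 z (k-1) ≠ 0)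
    (U : Set (ℝ × ℝ)) (hUopen : IsOpen U) (hUne : U.Nonempty)
    (a b c : ℝ × ℝ → ℝ)
    (ha : ContDiffOn ℝ (⊤ : ℕ∞) a U) (hb : ContDiffOn ℝ (⊤ : ℕ∞) b U)
    (hc : ContDiffOn ℝ (⊤ : ℕ∞) c U)
    (hCod : Codazzi k η f11 f31 f12 f22 f32 U a b c)
    (hGauss : ∀ p ∈ U, a p * c p - (b p) ^ 2 = -1) :
    ∀ p ∈ U,
      fderiv ℝ a p (1, 0) = ε * η * (a p - c p) ∧
      fderiv ℝ b p (1, 0) = 2 * ε * η * b p ∧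
      fderiv ℝ a p (0, 1) = ε * β * (a p - c p) ∧
      fderiv ℝ b p (0, 1) = 2 * ε * β * b p ∧
      η * fderiv ℝ c p (0, 1) - β * fderiv ℝ c p (1, 0) = 0 ∧
      a p ≠ 0 := by
  intro p hp
  have hU : U ∈ nhds p := hUopen.mem_nhds hp
  have hg : Differentiable ℝ f12 := hf12.differentiable (by simp)
  obtain ⟨hat, hax, -⟩ := coeffs_eq_zero (A := fderiv ℝ a p (0, 1) - ε * β * (a p - c p))
    (B := ε * η * (a p - c p) - fderiv ℝ a p (1, 0))
    (C := η * fderiv ℝ b p (0, 1) - β * fderiv ℝ b p (1, 0))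
    (by omega : 0 < k - 1) (hf11' 0) hg (hf12' 0) (by
      intro z
      have h := (hCod p hp z).1
      rw [hI31, hI32, hI22] at h
      linear_combination h)
  obtain ⟨hbt, hbx, hct⟩ := coeffs_eq_zero (A := fderiv ℝ b p (0, 1) - 2 * ε * β * b p)
    (B := 2 * ε * η * b p - fderiv ℝ b p (1, 0))
    (C := η * fderiv ℝ c p (0, 1) - β * fderiv ℝ c p (1, 0))
    (by omega : 0 < k - 1) (hf11' 0) hg (hf12' 0) (by
      intro z
      have h := (hCod p hp z).2
      rw [hI31, hI32, hI22] at h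
      linear_combination h)
  refine ⟨by linarith, by linarith, by linarith, by linarith, hct, fun ha0 => ?_⟩
  have da : HasFDerivAt a (fderiv ℝ a p) p :=
    ((ha.contDiffAt hU).differentiableAt (by simp)).hasFDerivAt
  have db : HasFDerivAt b (fderiv ℝ b p) p :=
    ((hb.contDiffAt hU).differentiableAt (by simp)).hasFDerivAt
  have dc : HasFDerivAt c (fderiv ℝ c p) p :=
    ((hc.contDiffAt hU).differentiableAt (by simp)).hasFDerivAt
  have hd := ((da.mul dc).sub (db.mul db)).congr_of_eventuallyEq
    (f₁ := fun _ => (-1 : ℝ)) (by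
      filter_upwards [hU] with q hq
      have := hGauss q hq
      simp only [Pi.sub_apply, Pi.mul_apply]
      linarith)
  have hx := congrArg (fun L : ℝ × ℝ →L[ℝ] ℝ => L (1, 0))
    (hd.unique (hasFDerivAt_const (-1 : ℝ) p))
  have hG := hGauss p hp
  simp only [ha0, sub_apply, add_apply,
    smul_apply, smul_eq_mul, zero_apply] at hx hG hax
  have hεη : ε * η ≠ 0 := mul_ne_zero (by rcases hε with h | h <;> simp [h]) hη
  have key : ε * η * (c p ^ 2 + 4) = 0 := by
    linear_combination -hx - c p * hax + 2 * b p * hbx + 4 * ε * η * hG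
  rcases mul_eq_zero.1 key with h | h
  · exact hεη h
  · nlinarith [sq_nonneg (c p)]
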